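/- Let IR > 0 be a real number and r₀, r₁ ∈ [0,1) with r₀ ≥ r₁. Then the posterior shift satisfies the lower bound (1−r₁)/(IR(1−r₀)+(1−r₁)) − 1/(1+IR) ≥ IR(r₀−r₁) / (1+IR)². -/

import Mathlib

/-- For IR > 0 and r₀, r₁ ∈ [0,1) with r₀ ≥ r₁, the posterior shift
satisfies (1−r₁)/(IR(1−r₀)+(1−r₁)) − 1/(1+IR) ≥ IR(r₀−r₁)/(1+IR)². -/
theorem posterior_shift_lower_bound (IR r₀ r₁ : ℝ) (hIR : 0 < IR)
    (hr₀ : r₀ ∈ Set.Ico (0:ℝ) 1) (hr₁ : r₁ ∈ Set.Ico (0:ℝ) 1)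
    (h : r₀ ≥ r₁) :
    (1 - r₁) / (IR * (1 - r₀) + (1 - r₁)) - 1 / (1 + IR) ≥
      IR * (r₀ - r₁) / (1 + IR) ^ 2 := by
  obtain ⟨h0, h0'⟩ := hr₀
  obtain ⟨h1, h1'⟩ := hr₁
  have hD : 0 < IR * (1 - r₀) + (1 - r₁) := by
    have := mul_pos hIR (sub_pos.mpr h0')
    linarith
  have hS : 0 < 1 + IR := by linarith
  have hle : IR * (1 - r₀) + (1 - r₁) ≤ 1 + IR := by
    have := mul_nonneg hIR.le h0
    linarith
  have key : (1 - r₁) / (IR * (1 - r₀) + (1 - r₁)) - 1 / (1 + IR) =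
      IR * (r₀ - r₁) / ((IR * (1 - r₀) + (1 - r₁)) * (1 + IR)) := by
    rw [div_sub_div _ _ hD.ne' hS.ne']
    congr 1
    ring
  rw [key, ge_iff_le]
  apply div_le_div_of_nonneg_left (mul_nonneg hIR.le (sub_nonneg.mpr h)) (mul_pos hD hS)
  rw [sq]
  exact mul_le_mul_of_nonneg_right hle hS.le
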